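/- arXiv:2502.02617 — 3 statements merged into one kernel-verified Lean document; each statement's English description precedes it below -/
import Mathlib

section
/- Let d be a positive integer and let X, Y ≥ 0 be two independent random variables each with probability density function f_Z(z) = (2 / (2^(d/2) · Γ(d/2))) · z^(d−1) · exp(−z²/2) on [0, ∞) (so that X² and Y² are chi-squared with d degrees of freedom). Then the random angle Θ = arctan(Y / X) takes values in [0, π/2] and has probability density function f_Θ(θ) = (Γ(d) / (2^(d−2) · Γ(d/2)²)) · sin^(d−1)(2θ) for 0 ≤ θ ≤ π/2. -/
open MeasureTheory ProbabilityTheory Real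

/-- The generalized gamma (chi) density with parameter `d`, as an `ℝ≥0∞`-valued density:
`f_Z(z) = 2 / (2^(d/2) Γ(d/2)) · z^(d-1) · exp(-z²/2)` for `z ≥ 0`. -/
noncomputable def genGammaDensity (d : ℕ) : ℝ → ENNReal :=
  Set.indicator (Set.Ici (0 : ℝ)) fun z =>
    ENNReal.ofReal
      (2 / (2 ^ ((d : ℝ) / 2) * Real.Gamma ((d : ℝ) / 2)) * z ^ (d - 1) * Real.exp (-z ^ 2 / 2))

lemma radial_integral (n : ℕ) (K : ℝ) (hK : 0 ≤ K) :
    ∫⁻ r in Set.Ioi (0:ℝ), ENNReal.ofReal (K * (r ^ (2 * n + 1) * Real.exp (-r ^ 2 / 2)))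
      = ENNReal.ofReal (K * (2 ^ n * Real.Gamma (n + 1))) := by
  have hi := integrableOn_rpow_mul_exp_neg_mul_rpow (s := 2 * n + 1) (p := 2) (b := 1/2)
    (by have : (0:ℝ) ≤ n := n.cast_nonneg
        linarith) (by norm_num) (by norm_num)
  have hv := integral_rpow_mul_exp_neg_mul_rpow (q := 2 * n + 1) (p := 2) (b := 1/2)
    (by norm_num) (by have : (0:ℝ) ≤ n := n.cast_nonneg
                      linarith) (by norm_num)
  have he : ∀ r : ℝ, r ^ (2 * (n:ℝ) + 1) * Real.exp (-(1/2) * r ^ (2:ℝ))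
      = r ^ (2 * n + 1) * Real.exp (-r ^ 2 / 2) := by
    intro r
    have h1 : r ^ (2 * (n:ℝ) + 1) = r ^ (2 * n + 1) := by
      rw [← Real.rpow_natCast]; push_cast; rfl
    have h2 : r ^ (2:ℝ) = r ^ 2 := by
      rw [← Real.rpow_natCast]; norm_num
    rw [h1, h2]; congr 2; ring
  simp only [he] at hi hv
  rw [← ofReal_integral_eq_lintegral_ofReal (hi.const_mul K)]
  · rw [integral_const_mul, hv]
    have h3 : (2 * (n:ℝ) + 1 + 1) / 2 = ((n + 1 : ℕ) : ℝ) := by push_cast; ring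
    have h4 : -(2 * (n:ℝ) + 1 + 1) / 2 = -((n + 1 : ℕ) : ℝ) := by push_cast; ring
    rw [h4, h3, Real.rpow_neg (by norm_num), Real.rpow_natCast]
    congr 2
    push_cast
    rw [one_div, inv_pow, inv_inv, pow_succ]; ring
  · filter_upwards [ae_restrict_mem measurableSet_Ioi] with r hr
    have : (0:ℝ) < r := hr
    simp only [Pi.zero_apply]
    positivity

lemma measurable_genGammaDensity (d : ℕ) : Measurable (genGammaDensity d) := by
  unfold genGammaDensity
  apply Measurable.indicator _ measurableSet_Ici
  fun_prop

lemma const_eq (n : ℕ) (t : ℝ) :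
    (2 / (2 ^ (((n+1 : ℕ) : ℝ) / 2) * Real.Gamma (((n+1 : ℕ) : ℝ) / 2))) ^ 2
      * (t / 2) ^ n * (2 ^ n * Real.Gamma (n + 1)) =
    Real.Gamma ((n+1 : ℕ) : ℝ) / (2 ^ (((n+1 : ℕ) : ℝ) - 2)
      * Real.Gamma (((n+1 : ℕ) : ℝ) / 2) ^ 2) * t ^ n := by
  have h1 : ((2:ℝ) ^ (((n+1 : ℕ) : ℝ) / 2)) ^ 2 = 2 ^ (n+1) := by
    rw [← Real.rpow_natCast, ← Real.rpow_mul (by norm_num), ← Real.rpow_natCast]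
    congr 1; push_cast; ring
  have h2 : (2:ℝ) ^ (((n+1 : ℕ) : ℝ) - 2) = 2 ^ (n+1) / 4 := by
    rw [Real.rpow_sub (by norm_num), Real.rpow_natCast]; norm_num
  have h3 : Real.Gamma (((n+1 : ℕ) : ℝ) / 2) ≠ 0 := (Real.Gamma_pos_of_pos (by positivity)).ne'
  rw [div_pow, mul_pow, h1, h2, div_pow]
  push_cast at *
  field_simp
  norm_num [mul_comm]

lemma inner_eq (n : ℕ) (s : Set ℝ) (θ : ℝ) (hθ : θ ∈ Set.Ioo (-π) π) (hne : θ ≠ π / 2) :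
    ∫⁻ r in Set.Ioi (0:ℝ), ENNReal.ofReal r *
      (((fun p : ℝ × ℝ => Real.arctan (p.2 / p.1)) ⁻¹' s).indicator
        (fun p : ℝ × ℝ => genGammaDensity (n+1) p.1 * genGammaDensity (n+1) p.2)
        (r * Real.cos θ, r * Real.sin θ)) =
    s.indicator (Set.indicator (Set.Icc (0 : ℝ) (π / 2)) fun θ =>
          ENNReal.ofReal
            (Real.Gamma ((n+1 : ℕ) : ℝ) / (2 ^ (((n+1 : ℕ) : ℝ) - 2)
              * Real.Gamma (((n+1 : ℕ) : ℝ) / 2) ^ 2) *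
              Real.sin (2 * θ) ^ (n + 1 - 1))) θ := by
  have hpi := Real.pi_pos
  by_cases hI : θ ∈ Set.Icc (0:ℝ) (π/2)
  · have hlt : θ < π / 2 := lt_of_le_of_ne hI.2 hne
    have hc : 0 < Real.cos θ := Real.cos_pos_of_mem_Ioo ⟨by linarith [hI.1], hlt⟩
    have hs : 0 ≤ Real.sin θ := Real.sin_nonneg_of_nonneg_of_le_pi hI.1 (by linarith)
    have hat : ∀ r ∈ Set.Ioi (0:ℝ), Real.arctan (r * Real.sin θ / (r * Real.cos θ)) = θ := by
      intro r hr
      rw [mul_div_mul_left _ _ (ne_of_gt hr), ← Real.tan_eq_sin_div_cos,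
        Real.arctan_tan (by linarith [hI.1]) hlt]
    by_cases hsθ : θ ∈ s
    · rw [Set.indicator_of_mem hsθ, Set.indicator_of_mem hI, Nat.add_sub_cancel, ← const_eq,
        ← radial_integral n _ (by
          have : 0 ≤ Real.sin (2 * θ) := by rw [Real.sin_two_mul]; positivity
          positivity)]
      apply setLIntegral_congr_fun measurableSet_Ioi
      intro r hr
      have hr0 : (0:ℝ) < r := hr
      have hmem : (r * Real.cos θ, r * Real.sin θ) ∈
          (fun p : ℝ × ℝ => Real.arctan (p.2 / p.1)) ⁻¹' s := by
        simp only [Set.mem_preimage, hat r hr, hsθ]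
      beta_reduce
      have hG : 0 < Real.Gamma (((n+1 : ℕ) : ℝ) / 2) := Real.Gamma_pos_of_pos (by positivity)
      rw [Set.indicator_of_mem hmem]
      unfold genGammaDensity
      rw [Set.indicator_of_mem (by simp only [Set.mem_Ici]; positivity),
        Set.indicator_of_mem (by simp only [Set.mem_Ici]; positivity),
        ← ENNReal.ofReal_mul (by positivity), ← ENNReal.ofReal_mul (by positivity)]
      congr 1
      have hexp : Real.exp (-r ^ 2 / 2) = Real.exp (-(r * Real.cos θ) ^ 2 / 2)
          * Real.exp (-(r * Real.sin θ) ^ 2 / 2) := by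
        rw [← Real.exp_add]; congr 1
        linear_combination (r ^ 2 / 2) * (Real.sin_sq_add_cos_sq θ)
      rw [hexp, Real.sin_two_mul]
      simp only [Nat.add_sub_cancel]
      rw [show 2 * Real.sin θ * Real.cos θ / 2 = Real.sin θ * Real.cos θ by ring]
      ring
    · rw [Set.indicator_of_notMem hsθ, ← lintegral_zero (μ := volume.restrict (Set.Ioi (0:ℝ)))]
      apply setLIntegral_congr_fun measurableSet_Ioi
      intro r hr
      beta_reduce
      rw [Set.indicator_of_notMem, mul_zero]
      simp only [Set.mem_preimage, hat r hr, hsθ, not_false_eq_true]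
  · have h0 : s.indicator (Set.indicator (Set.Icc (0 : ℝ) (π / 2)) fun θ =>
          ENNReal.ofReal
            (Real.Gamma ((n+1 : ℕ) : ℝ) / (2 ^ (((n+1 : ℕ) : ℝ) - 2)
              * Real.Gamma (((n+1 : ℕ) : ℝ) / 2) ^ 2) *
              Real.sin (2 * θ) ^ (n + 1 - 1))) θ = 0 := by
      simp only [Set.indicator, hI, if_false, ite_self]
    rw [h0, ← lintegral_zero (μ := volume.restrict (Set.Ioi (0:ℝ)))]
    apply setLIntegral_congr_fun measurableSet_Ioi
    intro r hr
    have hr0 : (0:ℝ) < r := hr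
    beta_reduce
    have hz : genGammaDensity (n+1) (r * Real.cos θ) * genGammaDensity (n+1) (r * Real.sin θ)
        = 0 := by
      unfold genGammaDensity
      by_cases h : θ < 0
      · have : Real.sin θ < 0 := Real.sin_neg_of_neg_of_neg_pi_lt h hθ.1
        rw [mul_eq_zero]; right
        rw [Set.indicator_of_notMem]
        simp only [Set.mem_Ici, not_le]
        exact mul_neg_of_pos_of_neg hr0 this
      · have h2 : π / 2 < θ := by
          by_contra h3
          exact hI ⟨not_lt.1 h, not_lt.1 h3⟩
        have : Real.cos θ < 0 := Real.cos_neg_of_pi_div_two_lt_of_lt h2 (by linarith [hθ.2])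
        rw [mul_eq_zero]; left
        rw [Set.indicator_of_notMem]
        simp only [Set.mem_Ici, not_le]
        exact mul_neg_of_pos_of_neg hr0 this
    simp only [Set.indicator, hz, ite_self, mul_zero]

/-- If `X, Y ≥ 0` are independent random variables each with the generalized gamma (chi)
density of parameter `d`, then `Θ = arctan(Y/X)` has density
`Γ(d) / (2^(d-2) Γ(d/2)²) · sin^(d-1)(2θ)` on `[0, π/2]`. -/
theorem arctan_ratio_of_chi_density (d : ℕ) (hd : 0 < d)
    {Ω : Type*} [MeasureSpace Ω] [IsProbabilityMeasure (ℙ : Measure Ω)]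
    (X Y : Ω → ℝ) (hX : Measurable X) (hY : Measurable Y)
    (hXpos : ∀ ω, 0 ≤ X ω) (hYpos : ∀ ω, 0 ≤ Y ω)
    (hindep : IndepFun X Y ℙ)
    (hXlaw : Measure.map X ℙ = volume.withDensity (genGammaDensity d))
    (hYlaw : Measure.map Y ℙ = volume.withDensity (genGammaDensity d)) :
    Measure.map (fun ω => Real.arctan (Y ω / X ω)) ℙ =
      volume.withDensity
        (Set.indicator (Set.Icc (0 : ℝ) (π / 2)) fun θ =>
          ENNReal.ofReal
            (Real.Gamma d / (2 ^ ((d : ℝ) - 2) * Real.Gamma ((d : ℝ) / 2) ^ 2) *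
              Real.sin (2 * θ) ^ (d - 1))) := by
  obtain ⟨n, rfl⟩ : ∃ n, d = n + 1 := ⟨d - 1, by omega⟩
  have hg := measurable_genGammaDensity (n+1)
  have hmeas : Measurable (fun p : ℝ × ℝ => Real.arctan (p.2 / p.1)) :=
    Real.measurable_arctan.comp (measurable_snd.div measurable_fst)
  have : SFinite (volume.withDensity (genGammaDensity (n+1))) := by
    rw [← hXlaw]; infer_instance
  have hlaw : Measure.map (fun ω => (X ω, Y ω)) ℙ = (volume : Measure (ℝ × ℝ)).withDensity
      (fun p => genGammaDensity (n+1) p.1 * genGammaDensity (n+1) p.2) := by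
    rw [(indepFun_iff_map_prod_eq_prod_map_map hX.aemeasurable hY.aemeasurable).1 hindep,
      hXlaw, hYlaw, prod_withDensity hg hg]
    rfl
  have hcomp : Measure.map (fun ω => Real.arctan (Y ω / X ω)) ℙ =
      Measure.map (fun p : ℝ × ℝ => Real.arctan (p.2 / p.1))
        (Measure.map (fun ω => (X ω, Y ω)) ℙ) := by
    rw [Measure.map_map hmeas (hX.prodMk hY)]; rfl
  rw [hcomp, hlaw]
  ext s hs
  have hfm : Measurable (((fun p : ℝ × ℝ => Real.arctan (p.2 / p.1)) ⁻¹' s).indicator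
        (fun p : ℝ × ℝ => genGammaDensity (n+1) p.1 * genGammaDensity (n+1) p.2)) :=
    ((hg.comp measurable_fst).mul (hg.comp measurable_snd)).indicator (hmeas hs)
  rw [Measure.map_apply hmeas hs, withDensity_apply _ (hmeas hs), withDensity_apply _ hs,
    ← lintegral_indicator (hmeas hs), ← lintegral_indicator hs,
    ← lintegral_comp_polarCoord_symm, polarCoord_target, Measure.volume_eq_prod,
    ← Measure.prod_restrict]
  simp only [polarCoord_symm_apply, smul_eq_mul]
  rw [lintegral_prod_symm]
  · symm
    rw [← setLIntegral_eq_of_support_subset (s := Set.Ioo (-π) π)]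
    · apply lintegral_congr_ae
      filter_upwards [ae_restrict_mem measurableSet_Ioo,
        ae_restrict_of_ae (Measure.ae_ne volume (π/2))] with θ hθ hne
      exact (inner_eq n s θ hθ hne).symm
    · intro θ hθ
      have hI : θ ∈ Set.Icc (0:ℝ) (π / 2) := by
        by_contra hI
        apply hθ
        simp only [Set.indicator, hI, if_false, ite_self]
      have hpi := Real.pi_pos
      exact ⟨by linarith [hI.1], by linarith [hI.2]⟩
  · apply Measurable.aemeasurable
    apply Measurable.mul (by fun_prop)
    exact hfm.comp (by fun_prop)
end

section
/- There exists a universal constant C > 0 such that the following holds. Let X be a random variable taking values in [0, π/2] with variance σ² where σ ∈ (0, 1). For a finite set S ⊂ ℝ and a real x, write d(x, S) = min_{s ∈ S} |x − s|, and define Var_k(X) = inf over all sets S of size k of E[d(X, S)²]. Then for every ε ∈ (0, 1) and every integer k ≥ C·(1 + log(1/σ))/√ε, one has Var_k(X) ≤ ε·σ² = ε·Var₁(X). -/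
open MeasureTheory ProbabilityTheory Real

lemma net_exists (m σ ε : ℝ) (k : ℕ) (hσ : 0 < σ) (hσ1 : σ < 1) (hε : 0 < ε) (hε1 : ε < 1)
    (hk : 14 * (1 + Real.log (1 / σ)) / Real.sqrt ε ≤ (k : ℝ)) :
    ∃ S : Finset ℝ, S.card = k ∧ ∀ x : ℝ, |x - m| ≤ 2 →
      Metric.infDist x (S : Set ℝ) ≤ Real.sqrt ε / 2 * (σ + |x - m|) := by
  have hs0 : 0 < Real.sqrt ε := Real.sqrt_pos.mpr hε
  have hs1 : Real.sqrt ε < 1 := by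
    rw [Real.sqrt_lt' one_pos]; linarith
  set s := Real.sqrt ε with hs
  have hL0 : 0 ≤ Real.log (1 / σ) := Real.log_nonneg (by rw [le_div_iff₀ hσ]; linarith)
  set L := Real.log (1 / σ) with hL
  set δ := s / 2 with hδ
  have hδ0 : 0 < δ := by positivity
  set N := ⌊6 * (1 + L) / s⌋₊ + 1 with hN
  have hA1 : 1 ≤ (1 + L) / s := by rw [le_div_iff₀ hs0]; linarith
  have hNk : 2 * N ≤ k := by
    have h1 : ((⌊6 * (1 + L) / s⌋₊ : ℕ) : ℝ) ≤ 6 * (1 + L) / s := Nat.floor_le (by positivity)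
    have h2 : (2 * N : ℝ) ≤ k := by
      refine le_trans ?_ hk
      rw [hN]; push_cast
      have e1 : 6 * (1 + L) / s = 6 * ((1 + L) / s) := by ring
      have e2 : 14 * (1 + L) / s = 14 * ((1 + L) / s) := by ring
      rw [e2]
      have : ((⌊6 * (1 + L) / s⌋₊ : ℕ) : ℝ) ≤ 6 * ((1 + L) / s) := by rw [← e1]; exact h1
      linarith
    exact_mod_cast h2
  let f : ℕ → ℝ := fun j => m + σ * ((1 + δ) ^ j - 1)
  let g : ℕ → ℝ := fun j => m - σ * ((1 + δ) ^ j - 1)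
  let T : Finset ℝ := (Finset.range N).image f ∪ (Finset.range N).image g
  have hT : T.card ≤ k := by
    have h1 := Finset.card_union_le ((Finset.range N).image f) ((Finset.range N).image g)
    have h2 := Finset.card_image_le (s := Finset.range N) (f := f)
    have h3 := Finset.card_image_le (s := Finset.range N) (f := g)
    rw [Finset.card_range] at h2 h3
    change ((Finset.range N).image f ∪ (Finset.range N).image g).card ≤ k
    omega
  obtain ⟨S, hTS, hS⟩ := Infinite.exists_superset_card_eq T k hT
  refine ⟨S, hS, fun x hx => ?_⟩
  set t := |x - m| with ht
  have ht0 : 0 ≤ t := abs_nonneg _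
  obtain ⟨j, hj1, hj2⟩ := exists_nat_pow_near (x := (σ + t) / σ) (y := 1 + δ)
    (by rw [le_div_iff₀ hσ]; linarith) (by linarith)
  have hjN : j < N := by
    have h3 : (1 + δ) ^ j ≤ 3 * (1 / σ) := by
      refine hj1.trans ?_
      rw [mul_one_div]
      gcongr
      linarith
    have h4 := Real.log_le_log (by positivity) h3
    rw [Real.log_pow, Real.log_mul (by norm_num) (by positivity), ← hL] at h4
    have h5 : Real.log 3 ≤ 2 := by
      have := Real.log_le_sub_one_of_pos (show (0:ℝ) < 3 by norm_num)
      linarith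
    have h6 : s / 3 ≤ Real.log (1 + δ) := by
      have := Real.one_sub_inv_le_log_of_pos (show (0:ℝ) < 1 + δ by linarith)
      refine le_trans ?_ this
      have h : (1 + δ) * (1 + δ)⁻¹ = 1 := mul_inv_cancel₀ (by linarith)
      have h' : 0 < (1 + δ)⁻¹ := by positivity
      have : 1 - (1 + δ)⁻¹ = δ * (1 + δ)⁻¹ := by linarith
      rw [this, ← div_eq_mul_inv, le_div_iff₀ (by linarith), hδ]
      nlinarith
    have h7 : (j : ℝ) * (s / 3) ≤ 2 + L := by
      have := mul_le_mul_of_nonneg_left h6 (Nat.cast_nonneg (α := ℝ) j)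
      linarith
    have h8 : (j : ℝ) ≤ 6 * (1 + L) / s := by
      rw [le_div_iff₀ hs0]; linarith
    have := Nat.le_floor h8
    omega
  have hj1' : σ * (1 + δ) ^ j ≤ σ + t := by
    rw [le_div_iff₀ hσ] at hj1; linarith
  have hj2' : σ + t < σ * (1 + δ) ^ j + δ * (σ * (1 + δ) ^ j) := by
    rw [div_lt_iff₀ hσ, pow_succ] at hj2; linarith
  have hj3 : δ * (σ * (1 + δ) ^ j) ≤ δ * (σ + t) := mul_le_mul_of_nonneg_left hj1' hδ0.le
  rcases le_total 0 (x - m) with h | h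
  · have hm : f j ∈ (S : Set ℝ) := hTS (Finset.mem_union_left _
      (Finset.mem_image_of_mem _ (Finset.mem_range.mpr hjN)))
    refine (Metric.infDist_le_dist_of_mem hm).trans ?_
    have : t = x - m := abs_of_nonneg h
    rw [Real.dist_eq, abs_le]
    simp only [f]
    constructor <;> nlinarith
  · have hm : g j ∈ (S : Set ℝ) := hTS (Finset.mem_union_right _
      (Finset.mem_image_of_mem _ (Finset.mem_range.mpr hjN)))
    refine (Metric.infDist_le_dist_of_mem hm).trans ?_
    have : t = -(x - m) := abs_of_nonpos h
    rw [Real.dist_eq, abs_le]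
    simp only [g]
    constructor <;> nlinarith

/-- There is a universal constant `C > 0` such that for every random variable `X` with values
in `[0, π/2]` and variance `σ² ` (`σ ∈ (0,1)`), every `ε ∈ (0,1)` and every
`k ≥ C (1 + log(1/σ)) / √ε`, the optimal `k`-point quantization error satisfies
`Var_k(X) ≤ ε σ²`: there is a `k`-point set `S` with `E[dist(X, S)²] ≤ ε σ²`. -/
theorem kpoint_quantization_error_of_variance :
    ∃ C : ℝ, 0 < C ∧
      ∀ (Ω : Type) (_ : MeasureSpace Ω) (_ : IsProbabilityMeasure (ℙ : Measure Ω))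
        (X : Ω → ℝ) (σ : ℝ), Measurable X →
        (∀ ω, X ω ∈ Set.Icc (0 : ℝ) (π / 2)) →
        σ ∈ Set.Ioo (0 : ℝ) 1 →
        variance X ℙ = σ ^ 2 →
        ∀ ε ∈ Set.Ioo (0 : ℝ) 1, ∀ k : ℕ,
          C * (1 + Real.log (1 / σ)) / Real.sqrt ε ≤ (k : ℝ) →
          ∃ S : Finset ℝ, S.card = k ∧
            ∫ ω, (Metric.infDist (X ω) (S : Set ℝ)) ^ 2 ∂ℙ ≤ ε * σ ^ 2 := by
  refine ⟨14, by norm_num, ?_⟩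
  intro Ω _ _ X σ hX hXb hσ hvar ε hε k hk
  have hpi : π / 2 ≤ 2 := by have := Real.pi_le_four; linarith
  have hLp : MemLp X 2 (ℙ : Measure Ω) := by
    refine MemLp.of_bound hX.aestronglyMeasurable 2 (Filter.Eventually.of_forall fun ω => ?_)
    rw [Real.norm_eq_abs, abs_of_nonneg (hXb ω).1]
    exact (hXb ω).2.trans hpi
  have hint : Integrable X (ℙ : Measure Ω) := hLp.integrable (by norm_num)
  set m := ∫ ω, X ω ∂(ℙ : Measure Ω) with hm
  have hm0 : 0 ≤ m := integral_nonneg fun ω => (hXb ω).1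
  have hm2 : m ≤ 2 := by
    have := integral_mono hint (integrable_const (2 : ℝ)) (fun ω => (hXb ω).2.trans hpi)
    simpa using this
  obtain ⟨S, hS, hd⟩ := net_exists m σ ε k hσ.1 hσ.2 hε.1 hε.2 hk
  refine ⟨S, hS, ?_⟩
  have hsq : Integrable (fun ω => (X ω - m) ^ 2) (ℙ : Measure Ω) :=
    (hLp.sub (memLp_const m)).integrable_sq
  have hv : ∫ ω, (X ω - m) ^ 2 ∂(ℙ : Measure Ω) = σ ^ 2 := by
    rw [← hvar, variance_eq_integral hX.aemeasurable]
  calc ∫ ω, (Metric.infDist (X ω) (S : Set ℝ)) ^ 2 ∂ℙ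
      ≤ ∫ ω, (ε / 2 * (σ ^ 2 + (X ω - m) ^ 2)) ∂ℙ := by
        refine integral_mono_of_nonneg (Filter.Eventually.of_forall fun ω => sq_nonneg _)
          (((integrable_const _).add hsq).const_mul _) (Filter.Eventually.of_forall fun ω => ?_)
        have h0 := hXb ω
        have h1 := hd (X ω) (by rw [abs_le]; constructor <;> linarith [h0.1, h0.2])
        have h2 := pow_le_pow_left₀ Metric.infDist_nonneg h1 2
        refine h2.trans ?_
        beta_reduce
        rw [mul_pow, div_pow, Real.sq_sqrt hε.1.le, ← sq_abs (X ω - m)]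
        nlinarith [mul_nonneg hε.1.le (sq_nonneg (σ - |X ω - m|))]
    _ = ε * σ ^ 2 := by
        rw [integral_const_mul, integral_add (integrable_const _) hsq, hv]
        simp
        ring
end

section
/- For every integer d ≥ 2, ∫₀^{π/4} θ² · cos^{d−1}(2θ) dθ ≤ (√π · π³ / (64·√2)) · (d − 1)^{−3/2}. -/
open Real

lemma gauss_aux {a : ℝ} (ha : 0 < a) :
    ∫ x in Set.Ioi (0:ℝ), x ^ (2:ℝ) * Real.exp (-a * x ^ (2:ℝ)) = a ^ (-(3/2) : ℝ) * (√π / 4) := by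
  rw [integral_rpow_mul_exp_neg_mul_rpow (by norm_num) (by norm_num) ha]
  have h : Real.Gamma ((2 + 1) / 2) = √π / 2 := by
    rw [show ((2:ℝ) + 1) / 2 = 1 / 2 + 1 by norm_num, Real.Gamma_add_one (by norm_num),
      Real.Gamma_one_half_eq]
    ring
  rw [h, show (-(2 + 1) / 2 : ℝ) = -(3/2) by norm_num]
  ring

lemma point_aux (n : ℕ) (x : ℝ) (h0 : 0 ≤ x) (h1 : x ≤ π / 4) :
    x ^ 2 * Real.cos (2 * x) ^ n ≤ x ^ (2:ℝ) * Real.exp (-(8 * n / π ^ 2) * x ^ (2:ℝ)) := by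
  have hpi := Real.pi_pos
  rw [Real.rpow_two]
  have hs : 2 / π * x ≤ Real.sin x := Real.mul_le_sin h0 (by linarith)
  have hc0 : 0 ≤ Real.cos (2 * x) := Real.cos_nonneg_of_mem_Icc ⟨by linarith, by linarith⟩
  have hc : Real.cos (2 * x) ≤ Real.exp (-(8 / π ^ 2 * x ^ 2)) := by
    have h2 : (2 / π * x) ^ 2 ≤ Real.sin x ^ 2 := pow_le_pow_left₀ (by positivity) hs 2
    have h3 : Real.cos (2 * x) = 1 - 2 * Real.sin x ^ 2 := by
      rw [Real.cos_two_mul, Real.cos_sq']; ring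
    have h4 := Real.one_sub_le_exp_neg (8 / π ^ 2 * x ^ 2)
    have h5 : 8 / π ^ 2 * x ^ 2 = 2 * (2 / π * x) ^ 2 := by field_simp; ring
    linarith
  have h6 := pow_le_pow_left₀ hc0 hc n
  rw [← Real.exp_nat_mul] at h6
  refine mul_le_mul_of_nonneg_left (h6.trans_eq ?_) (by positivity)
  congr 1; ring

/-- For every integer `d ≥ 2`,
`∫₀^{π/4} θ² cos^{d−1}(2θ) dθ ≤ (√π · π³ / (64 √2)) · (d − 1)^{−3/2}`. -/
theorem integral_theta_sq_cos_pow_le (d : ℕ) (hd : 2 ≤ d) :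
    ∫ θ in (0 : ℝ)..(π / 4), θ ^ 2 * Real.cos (2 * θ) ^ (d - 1) ≤
      Real.sqrt π * π ^ 3 / (64 * Real.sqrt 2) * ((d : ℝ) - 1) ^ (-(3 / 2) : ℝ) := by
  obtain ⟨n, rfl⟩ : ∃ n, d = n + 1 := ⟨d - 1, by omega⟩
  have hn : (0:ℝ) < n := by exact_mod_cast (show 0 < n by omega)
  have hpi := Real.pi_pos
  rw [Nat.add_sub_cancel, Nat.cast_add, Nat.cast_one, add_sub_cancel_right]
  have ha : (0:ℝ) < 8 * n / π ^ 2 := by positivity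
  have hint : MeasureTheory.IntegrableOn
      (fun x : ℝ => x ^ (2:ℝ) * Real.exp (-(8 * n / π ^ 2) * x ^ (2:ℝ))) (Set.Ioi 0) :=
    integrableOn_rpow_mul_exp_neg_mul_rpow (by norm_num) (by norm_num) ha
  have hsub : Set.Ioc 0 (π / 4) ⊆ Set.Ioi (0:ℝ) := fun x hx => hx.1
  have hle : (0:ℝ) ≤ π / 4 := by positivity
  have hf : IntervalIntegrable (fun x : ℝ => x ^ 2 * Real.cos (2 * x) ^ n)
      MeasureTheory.volume 0 (π / 4) := by
    apply Continuous.intervalIntegrable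
    fun_prop
  have e : (8 * n / π ^ 2 : ℝ) ^ (-(3/2) : ℝ) = π ^ 3 / (16 * √2) * (n:ℝ) ^ (-(3/2) : ℝ) := by
    rw [Real.div_rpow (by positivity) (by positivity), Real.mul_rpow (by positivity) hn.le]
    have e1 : (8:ℝ) ^ (-(3/2) : ℝ) = (16 * √2)⁻¹ := by
      rw [Real.rpow_neg (by norm_num)]
      congr 1
      rw [show (8:ℝ) = 2 ^ (3:ℝ) by norm_num, ← Real.rpow_mul (by norm_num),
        show (3 * (3 / 2) : ℝ) = (4:ℕ) + 1 / 2 by norm_num, Real.rpow_add (by norm_num),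
        Real.rpow_natCast, Real.sqrt_eq_rpow]
      norm_num
    have e2 : (π ^ 2) ^ (-(3/2) : ℝ) = (π ^ 3)⁻¹ := by
      rw [Real.rpow_neg (by positivity), ← Real.rpow_two, ← Real.rpow_mul hpi.le,
        show (2 * (3 / 2) : ℝ) = (3:ℕ) by norm_num, Real.rpow_natCast]
    rw [e1, e2]
    field_simp
  calc _ ≤ ∫ x in Set.Ioc 0 (π / 4), x ^ (2:ℝ) * Real.exp (-(8 * n / π ^ 2) * x ^ (2:ℝ)) := by
        rw [intervalIntegral.integral_of_le hle]
        exact MeasureTheory.setIntegral_mono_on hf.1 (hint.mono_set hsub) measurableSet_Ioc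
          fun x hx => point_aux n x hx.1.le hx.2
    _ ≤ ∫ x in Set.Ioi (0:ℝ), x ^ (2:ℝ) * Real.exp (-(8 * n / π ^ 2) * x ^ (2:ℝ)) := by
        apply MeasureTheory.setIntegral_mono_set hint
        · refine Filter.Eventually.of_forall fun x => ?_
          simp only [Pi.zero_apply, Real.rpow_two]
          positivity
        · exact hsub.eventuallyLE
    _ = _ := by
        rw [gauss_aux ha, e]
        field_simp
        norm_num
end
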